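/- arXiv:math/0404328 — 3 statements merged into one kernel-verified Lean document; each statement's English description precedes it below -/
import Mathlib

section
/- Let (L, R) be a weak factorization system on the category Set of sets. Then (L, R) is one of the following six pairs: (Iso, All), (Mono, Epi), (SplitMono, Epi ∪ Empty), (Epi, Mono), (All, Iso), (Iso ∪ NonEmpty, Iso ∪ Empty). In other words, these six pairs are the only weak factorization systems on the category of sets. -/
universe u

/-- A class of morphisms of the category `Set` of sets. -/
abbrev MapClass : Type (u + 1) := ∀ (X Y : Type u), (X → Y) → Prop

/-- `i` has the left lifting property (LLP) with respect to `p`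
(equivalently, `p` has the right lifting property (RLP) with respect to `i`):
every commutative square `p ∘ α = β ∘ i` admits a diagonal filler `g`. -/
def LiftSq {A B X Y : Type u} (i : A → B) (p : X → Y) : Prop :=
  ∀ (α : A → X) (β : B → Y), p ∘ α = β ∘ i →
    ∃ g : B → X, g ∘ i = α ∧ p ∘ g = β

/-- `All`: the class of all set maps. -/
def AllMaps : MapClass.{u} := fun _ _ _ => True

/-- `Iso`: the class of bijections. -/
def IsoMaps : MapClass.{u} := fun _ _ f => Function.Bijective f

/-- `Mono`: the class of injections. -/
def MonoMaps : MapClass.{u} := fun _ _ f => Function.Injective f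

/-- `Epi`: the class of surjections. -/
def EpiMaps : MapClass.{u} := fun _ _ f => Function.Surjective f

/-- `SplitMono`: the class of set maps having a left inverse. -/
def SplitMonoMaps : MapClass.{u} := fun X Y f => ∃ g : Y → X, g ∘ f = id

/-- `Empty`: the class of set maps whose domain is empty. -/
def EmptyMaps : MapClass.{u} := fun X _Y _f => IsEmpty X

/-- `NonEmpty`: the class of set maps whose domain is nonempty. -/
def NonEmptyMaps : MapClass.{u} := fun X _Y _f => Nonempty X

/-- The union of two classes of set maps. -/
def unionMaps (P Q : MapClass.{u}) : MapClass.{u} := fun X Y f => P X Y f ∨ Q X Y f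

/-- `(L, R)` is a weak factorization system on the category of sets:
`L` is exactly the class of maps having the LLP with respect to every member of `R`,
`R` is exactly the class of maps having the RLP with respect to every member of `L`,
and every set map factors as `r ∘ l` with `l ∈ L` and `r ∈ R`. -/
structure IsWFS (L R : MapClass.{u}) : Prop where
  left_iff : ∀ {A B : Type u} (i : A → B),
    L A B i ↔ ∀ {X Y : Type u} (p : X → Y), R X Y p → LiftSq i p
  right_iff : ∀ {X Y : Type u} (p : X → Y),
    R X Y p ↔ ∀ {A B : Type u} (i : A → B), L A B i → LiftSq i p
  factor : ∀ {X Y : Type u} (f : X → Y),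
    ∃ (Z : Type u) (l : X → Z) (r : Z → Y), L X Z l ∧ R Z Y r ∧ r ∘ l = f

/-- Injections lift against surjections. -/
theorem LiftSq.of_injective_surjective {A B X Y : Type u} {i : A → B} {p : X → Y}
    (hi : Function.Injective i) (hp : Function.Surjective p) : LiftSq i p := by
  classical
  intro α β hsq
  have hg : ∀ b, ∃ x, p x = β b ∧ ∀ a, i a = b → x = α a := by
    intro b
    by_cases hb : ∃ a, i a = b
    · obtain ⟨a, rfl⟩ := hb
      exact ⟨α a, congrFun hsq a, fun a' ha' => by rw [hi ha']⟩
    · obtain ⟨x, hx⟩ := hp (β b)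
      exact ⟨x, hx, fun a ha => (hb ⟨a, ha⟩).elim⟩
  choose g hg₁ hg₂ using hg
  exact ⟨g, funext fun a => hg₂ _ a rfl, funext hg₁⟩

/-- Surjections lift against injections. -/
theorem LiftSq.of_surjective_injective {A B X Y : Type u} {i : A → B} {p : X → Y}
    (hi : Function.Surjective i) (hp : Function.Injective p) : LiftSq i p := by
  intro α β hsq
  have hs := congrFun hsq
  simp only [Function.comp_apply] at hs
  refine ⟨fun b => α (Function.surjInv hi b), funext fun a => hp ?_, funext fun b => ?_⟩
  · simp [hs, Function.surjInv_eq]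
  · simp [hs, Function.surjInv_eq]

/-- Bijections lift against every map. -/
theorem LiftSq.of_bijective_left {A B X Y : Type u} {i : A → B} (p : X → Y)
    (hi : Function.Bijective i) : LiftSq i p := by
  intro α β hsq
  obtain ⟨j, hji, hij⟩ := Function.bijective_iff_has_inverse.1 hi
  refine ⟨α ∘ j, funext fun a => congrArg α (hji a), ?_⟩
  rw [← Function.comp_assoc, hsq, Function.comp_assoc, hij.comp_eq_id, Function.comp_id]

/-- Every map lifts against bijections. -/
theorem LiftSq.of_bijective_right {A B X Y : Type u} (i : A → B) {p : X → Y}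
    (hp : Function.Bijective p) : LiftSq i p := by
  intro α β hsq
  obtain ⟨q, hqp, hpq⟩ := Function.bijective_iff_has_inverse.1 hp
  refine ⟨q ∘ β, ?_, funext fun b => hpq (β b)⟩
  rw [Function.comp_assoc, ← hsq, ← Function.comp_assoc, hqp.comp_eq_id, Function.id_comp]

/-- Maps with nonempty domain lift vacuously against maps with empty domain. -/
theorem LiftSq.of_nonempty_isEmpty {A B X Y : Type u} [Nonempty A] [IsEmpty X]
    (i : A → B) (p : X → Y) : LiftSq i p :=
  fun α _ _ => isEmptyElim (α (Classical.arbitrary A))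

/-- A map with the right lifting property against a non-injective map is injective. -/
theorem LiftSq.injective_right {A B X Y : Type u} {i : A → B} {p : X → Y}
    (h : LiftSq i p) (hi : ¬ Function.Injective i) : Function.Injective p := by
  classical
  intro x x' hx
  simp only [Function.Injective, not_forall] at hi
  obtain ⟨a, a', haa, hne⟩ := hi
  obtain ⟨g, hg, -⟩ := h (fun c => if c = a then x else x') (fun _ => p x)
    (funext fun c => by by_cases hc : c = a <;> simp [hc, hx])
  have h₁ := congrFun hg a
  have h₂ := congrFun hg a'
  simp only [Function.comp_apply, if_true, if_neg (Ne.symm hne)] at h₁ h₂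
  rw [← h₁, ← h₂, haa]

/-- A map with the right lifting property against a non-surjective map is surjective if the
former has nonempty domain or the latter has empty domain. -/
theorem LiftSq.surjective_right {A B X Y : Type u} {i : A → B} {p : X → Y}
    (h : LiftSq i p) (hi : ¬ Function.Surjective i) (hA : IsEmpty A ∨ Nonempty X) :
    Function.Surjective p := by
  classical
  intro y
  simp only [Function.Surjective, not_forall] at hi
  obtain ⟨b, hb⟩ := hi
  rcases hA with hA | ⟨⟨x⟩⟩
  · obtain ⟨g, -, hg⟩ := h isEmptyElim (fun _ => y) (funext isEmptyElim)
    exact ⟨g b, congrFun hg b⟩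
  · obtain ⟨g, -, hg⟩ := h (fun _ => x) (fun c => if c = b then y else p x) (funext fun a => by
      have : i a ≠ b := fun e => hb ⟨a, e⟩
      simp [this])
    exact ⟨g b, by simpa using congrFun hg b⟩

/-- A map is a split monomorphism when it is injective and has nonempty domain or is surjective. -/
theorem splitMonoMaps_of_injective {A B : Type u} {i : A → B} (hi : Function.Injective i)
    (h : Nonempty A ∨ Function.Surjective i) : SplitMonoMaps A B i := by
  rcases h with h | h
  · exact ⟨Function.invFun i, Function.invFun_comp hi⟩
  · obtain ⟨j, hj, -⟩ := Function.bijective_iff_has_inverse.1 ⟨hi, h⟩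
    exact ⟨j, hj.comp_eq_id⟩

/-- Split monomorphisms lift against maps that are surjective or have empty domain. -/
theorem SplitMonoMaps.liftSq {A B X Y : Type u} {i : A → B} {p : X → Y}
    (hi : SplitMonoMaps A B i) (hp : unionMaps EpiMaps EmptyMaps X Y p) : LiftSq i p := by
  obtain ⟨j, hj⟩ := hi
  have hinj : Function.Injective i := (Function.leftInverse_iff_comp.2 hj).injective
  rcases hp with hp | hp
  · exact .of_injective_surjective hinj hp
  · have : IsEmpty X := hp
    rcases isEmpty_or_nonempty A with hA | hA
    · exact .of_bijective_left p ⟨hinj, fun b => isEmptyElim (j b)⟩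
    · exact .of_nonempty_isEmpty i p

/-- A weak factorization system contained in a pair of mutually lifting classes equals it. -/
theorem IsWFS.eq_of_le {L R L₀ R₀ : MapClass.{u}} (h : IsWFS L R)
    (hL : ∀ {A B : Type u} (i : A → B), L A B i → L₀ A B i)
    (hR : ∀ {X Y : Type u} (p : X → Y), R X Y p → R₀ X Y p)
    (hlift : ∀ {A B X Y : Type u} (i : A → B) (p : X → Y),
      L₀ A B i → R₀ X Y p → LiftSq i p) : L = L₀ ∧ R = R₀ := by
  constructor
  · funext A B i
    exact propext ⟨hL i, fun hi => (h.left_iff i).2 fun p hp => hlift i p hi (hR p hp)⟩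
  · funext X Y p
    exact propext ⟨hR p, fun hp => (h.right_iff p).2 fun i hi => hlift i p (hL i hi) hp⟩

/-- The six pairs `(Iso, All)`, `(Mono, Epi)`, `(SplitMono, Epi ∪ Empty)`, `(Epi, Mono)`,
`(All, Iso)` and `(Iso ∪ NonEmpty, Iso ∪ Empty)` are the only weak factorization systems
on the category of sets. -/
theorem wfs_classification_of_set (L R : MapClass.{u}) (h : IsWFS L R) :
    (L = IsoMaps ∧ R = AllMaps) ∨
    (L = MonoMaps ∧ R = EpiMaps) ∨
    (L = SplitMonoMaps ∧ R = unionMaps EpiMaps EmptyMaps) ∨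
    (L = EpiMaps ∧ R = MonoMaps) ∨
    (L = AllMaps ∧ R = IsoMaps) ∨
    (L = unionMaps IsoMaps NonEmptyMaps ∧ R = unionMaps IsoMaps EmptyMaps) := by
  have lift : ∀ {A B X Y : Type u} {i : A → B} {p : X → Y}, L A B i → R X Y p → LiftSq i p :=
    fun hi hp => (h.left_iff _).1 hi _ hp
  by_cases hepi : ∀ {A B : Type u} (i : A → B), L A B i → Function.Surjective i
  · by_cases hmono : ∀ {A B : Type u} (i : A → B), L A B i → Function.Injective i
    · exact .inl (h.eq_of_le (fun i hi => ⟨hmono i hi, hepi i hi⟩) (fun _ _ => trivial)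
        fun _ p hi _ => .of_bijective_left p hi)
    · push Not at hmono
      obtain ⟨_, _, _, hi, hni⟩ := hmono
      exact .inr <| .inr <| .inr <| .inl (h.eq_of_le hepi
        (fun _ hp => (lift hi hp).injective_right hni)
        fun _ _ => .of_surjective_injective)
  have hepi' : ∃ (A B : Type u) (i : A → B), L A B i ∧ ¬ Function.Surjective i := by
    push Not at hepi
    exact hepi
  by_cases hempty : ∀ {A B : Type u} (i : A → B), L A B i → Nonempty A ∨ Function.Surjective i
  · have hR : ∀ {X Y : Type u} (p : X → Y), R X Y p → unionMaps EpiMaps EmptyMaps X Y p := by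
      intro X Y p hp
      obtain ⟨_, _, _, hi, hni⟩ := hepi'
      rcases isEmpty_or_nonempty X with hX | hX
      · exact .inr hX
      · exact .inl ((lift hi hp).surjective_right hni (.inr hX))
    by_cases hmono : ∀ {A B : Type u} (i : A → B), L A B i → Function.Injective i
    · exact .inr <| .inr <| .inl (h.eq_of_le
        (fun i hi => splitMonoMaps_of_injective (hmono i hi) (hempty i hi)) hR
        fun _ _ hi hp => hi.liftSq hp)
    · push Not at hmono
      obtain ⟨_, _, _, hi, hni⟩ := hmono
      refine .inr <| .inr <| .inr <| .inr <| .inr (h.eq_of_le ?_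
        (fun p hp => (hR p hp).imp_left fun hs => ⟨(lift hi hp).injective_right hni, hs⟩) ?_)
      · intro A B j hj
        rcases isEmpty_or_nonempty A with hA | hA
        · exact .inl ⟨Function.injective_of_subsingleton j,
            (hempty j hj).resolve_left (not_nonempty_iff.2 hA)⟩
        · exact .inr hA
      · rintro A B X Y j p (hj | hj) hp
        · exact .of_bijective_left p hj
        · rcases hp with hp | hp
          · exact .of_bijective_right j hp
          · have : Nonempty A := hj
            have : IsEmpty X := hp
            exact .of_nonempty_isEmpty j p
  · push Not at hempty
    obtain ⟨_, _, _, hi, hA, hni⟩ := hempty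
    have hR : ∀ {X Y : Type u} (p : X → Y), R X Y p → Function.Surjective p :=
      fun _ hp => (lift hi hp).surjective_right hni (.inl hA)
    by_cases hmono : ∀ {A B : Type u} (i : A → B), L A B i → Function.Injective i
    · exact .inr <| .inl (h.eq_of_le hmono hR fun _ _ => .of_injective_surjective)
    · push Not at hmono
      obtain ⟨_, _, _, hj, hnj⟩ := hmono
      exact .inr <| .inr <| .inr <| .inr <| .inl (h.eq_of_le (fun _ _ => trivial)
        (fun p hp => ⟨(lift hj hp).injective_right hnj, hR p hp⟩)
        fun i _ _ hp => .of_bijective_right i hp)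
end

section
/- A triple of classes of set maps (Cof, Fib, W) is a model structure on the category Set of sets if and only if it is one of the following nine triples: (All, All, Iso), (All, Iso ∪ Empty, Iso ∪ NonEmpty), (All, Iso, All), (Iso, All, All), (Epi, Mono, All), (Mono, Epi, All), (SplitMono, Epi ∪ Empty, All), (Iso ∪ NonEmpty, Iso ∪ Empty, All), (Mono, Epi ∪ Empty, Iso ∪ NonEmpty). -/
universe u

/-- `f` is a retract of `g` in the arrow category of `Set`. -/
def IsRetract {X Y Z W : Type u} (f : X → Y) (g : Z → W) : Prop :=
  ∃ (i : X → Z) (p : Z → X) (j : Y → W) (q : W → Y),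
    p ∘ i = id ∧ q ∘ j = id ∧ g ∘ i = j ∘ f ∧ q ∘ g = f ∘ p

/-- `(Cof, Fib, W)` is a model structure on the category of sets: `W` is closed under
retracts and satisfies the two-out-of-three axiom, and both `(Cof ∩ W, Fib)` and
`(Cof, Fib ∩ W)` are weak factorization systems. -/
structure IsModelStructure (Cof Fib W : MapClass.{u}) : Prop where
  weq_retract : ∀ {X Y Z T : Type u} (f : X → Y) (g : Z → T),
    IsRetract f g → W Z T g → W X Y f
  weq_comp : ∀ {X Y Z : Type u} (f : X → Y) (g : Y → Z),
    W X Y f → W Y Z g → W X Z (g ∘ f)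
  weq_of_comp_left : ∀ {X Y Z : Type u} (f : X → Y) (g : Y → Z),
    W X Y f → W X Z (g ∘ f) → W Y Z g
  weq_of_comp_right : ∀ {X Y Z : Type u} (f : X → Y) (g : Y → Z),
    W Y Z g → W X Z (g ∘ f) → W X Y f
  wfs_trivCof_fib : IsWFS (fun X Y f => Cof X Y f ∧ W X Y f) Fib
  wfs_cof_trivFib : IsWFS Cof (fun X Y f => Fib X Y f ∧ W X Y f)

open Function

theorem liftSq_of_pointwise {A B X Y : Type u} {i : A → B} {p : X → Y}
    (h : ∀ (α : A → X) (β : B → Y), (∀ a, p (α a) = β (i a)) →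
      ∀ b, ∃ x, p x = β b ∧ ∀ a, i a = b → x = α a) : LiftSq i p := by
  intro α β hc
  choose g hg hg' using h α β (fun a => congrFun hc a)
  exact ⟨g, funext fun a => hg' _ a rfl, funext hg⟩

/-- The retract argument: lifting, factorization and closure under the two special kinds of
retracts give a weak factorization system. -/
theorem isWFS_of_retract {L R : MapClass.{u}}
    (lift : ∀ {A B X Y : Type u} (i : A → B) (p : X → Y), L A B i → R X Y p → LiftSq i p)
    (factor : ∀ {X Y : Type u} (f : X → Y),
      ∃ (Z : Type u) (l : X → Z) (r : Z → Y), L X Z l ∧ R Z Y r ∧ r ∘ l = f)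
    (left_retract : ∀ {A B Z : Type u} (i : A → B) (g : B → Z) (r : Z → B),
      L A Z (g ∘ i) → r ∘ g = id → L A B i)
    (right_retract : ∀ {X Y Z : Type u} (p : X → Y) (g : Z → X) (l : X → Z),
      R Z Y (p ∘ g) → g ∘ l = id → R X Y p) : IsWFS L R where
  left_iff i := by
    refine ⟨fun hi _ _ p hp => lift i p hi hp, fun h => ?_⟩
    obtain ⟨Z, l, r, hl, hr, hf⟩ := factor i
    obtain ⟨g, rfl, hg'⟩ := h r hr l id hf
    exact left_retract i g r hl hg'
  right_iff p := by
    refine ⟨fun hp _ _ i hi => lift i p hi hp, fun h => ?_⟩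
    obtain ⟨Z, l, r, hl, hr, hf⟩ := factor p
    obtain ⟨g, hg, rfl⟩ := h l hl id r hf.symm
    exact right_retract p g l hr hg
  factor := factor

theorem IsWFS.right_unique {L R R' : MapClass.{u}} (h : IsWFS L R) (h' : IsWFS L R') :
    R = R' := by
  funext X Y p
  exact propext ((h.right_iff p).trans (h'.right_iff p).symm)

theorem liftSq_mono_epi {A B X Y : Type u} {i : A → B} {p : X → Y}
    (hi : Injective i) (hp : Surjective p) : LiftSq i p := by
  refine liftSq_of_pointwise fun α β hc b => ?_
  by_cases hb : ∃ a, i a = b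
  · obtain ⟨a, rfl⟩ := hb
    exact ⟨α a, hc a, fun a' ha => by rw [hi ha]⟩
  · obtain ⟨x, hx⟩ := hp (β b)
    exact ⟨x, hx, fun a ha => (hb ⟨a, ha⟩).elim⟩

theorem liftSq_of_bijective_right {A B X Y : Type u} {i : A → B} {p : X → Y}
    (hp : Bijective p) : LiftSq i p := by
  refine liftSq_of_pointwise fun α β hc b => ?_
  obtain ⟨x, hx⟩ := hp.2 (β b)
  refine ⟨x, hx, ?_⟩
  rintro a rfl
  exact hp.1 (hx.trans (hc a).symm)

theorem liftSq_of_bijective_left {A B X Y : Type u} {i : A → B} {p : X → Y}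
    (hi : Bijective i) : LiftSq i p := by
  refine liftSq_of_pointwise fun α β hc b => ?_
  obtain ⟨a, rfl⟩ := hi.2 b
  exact ⟨α a, hc a, fun a' ha => by rw [hi.1 ha]⟩

theorem bijective_of_isEmpty {X Y : Type u} [IsEmpty X] [IsEmpty Y] (f : X → Y) :
    Bijective f :=
  ⟨fun x => isEmptyElim x, fun y => isEmptyElim y⟩

theorem injective_of_comp_eq_id {X Y : Type u} {f : X → Y} {g : Y → X} (h : g ∘ f = id) :
    Injective f :=
  LeftInverse.injective (congrFun h)

theorem surjective_of_comp_eq_id {X Y : Type u} {f : X → Y} {g : Y → X} (h : g ∘ f = id) :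
    Surjective g :=
  RightInverse.surjective (congrFun h)

theorem isWFS_all_iso : IsWFS.{u} AllMaps IsoMaps := by
  refine isWFS_of_retract ?_ ?_ ?_ ?_
  · exact fun i p _ hp => liftSq_of_bijective_right hp
  · exact fun {X Y} f => ⟨Y, f, id, trivial, bijective_id, rfl⟩
  · exact fun _ _ _ _ _ => trivial
  · intro X Y Z p g l hp hg
    have hg' : Bijective g := ⟨hp.1.of_comp, surjective_of_comp_eq_id hg⟩
    exact (Bijective.of_comp_iff p hg').1 hp

theorem isWFS_iso_all : IsWFS.{u} IsoMaps AllMaps := by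
  refine isWFS_of_retract ?_ ?_ ?_ ?_
  · exact fun i p hi _ => liftSq_of_bijective_left hi
  · exact fun {X Y} f => ⟨X, id, f, bijective_id, trivial, rfl⟩
  · intro A B Z i g r hi hg
    have hg' : Bijective g := ⟨injective_of_comp_eq_id hg, hi.2.of_comp⟩
    exact (Bijective.of_comp_iff' hg' i).1 hi
  · exact fun _ _ _ _ _ => trivial

theorem isWFS_epi_mono : IsWFS.{u} EpiMaps MonoMaps := by
  refine isWFS_of_retract ?_ ?_ ?_ ?_
  · intro A B X Y i p hi hp
    refine liftSq_of_pointwise fun α β hc b => ?_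
    obtain ⟨a, rfl⟩ := hi b
    exact ⟨α a, hc a, fun a' ha => hp (by rw [hc, hc, ha])⟩
  · exact fun {X Y} f => ⟨Set.range f, Set.rangeFactorization f, Subtype.val,
      Set.rangeFactorization_surjective, Subtype.val_injective, rfl⟩
  · intro A B Z i g r hi hg
    exact Surjective.of_comp_left hi (injective_of_comp_eq_id hg)
  · intro X Y Z p g l hp hg
    exact Injective.of_comp_right hp (surjective_of_comp_eq_id hg)

theorem isWFS_mono_epi : IsWFS.{u} MonoMaps EpiMaps := by
  refine isWFS_of_retract ?_ ?_ ?_ ?_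
  · exact fun i p hi hp => liftSq_mono_epi hi hp
  · exact fun {X Y} f => ⟨X ⊕ Y, Sum.inl, Sum.elim f id, Sum.inl_injective,
      fun y => ⟨Sum.inr y, rfl⟩, rfl⟩
  · exact fun i g r hi _ => Injective.of_comp hi
  · exact fun p g l hp _ => Surjective.of_comp hp

theorem isWFS_splitMono : IsWFS.{u} SplitMonoMaps (unionMaps EpiMaps EmptyMaps) := by
  refine isWFS_of_retract ?_ ?_ ?_ ?_
  · rintro A B X Y i p ⟨s, hs⟩ (hp | hX)
    · exact liftSq_mono_epi (injective_of_comp_eq_id hs) hp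
    · exact liftSq_of_pointwise fun α β hc b => (hX.false (α (s b))).elim
  · intro X Y f
    rcases isEmpty_or_nonempty X with hX | ⟨⟨x⟩⟩
    · exact ⟨X, id, f, ⟨id, rfl⟩, Or.inr hX, rfl⟩
    · exact ⟨X ⊕ Y, Sum.inl, Sum.elim f id, ⟨Sum.elim id fun _ => x, rfl⟩,
        Or.inl fun y => ⟨Sum.inr y, rfl⟩, rfl⟩
  · rintro A B Z i g r ⟨s, hs⟩ _
    exact ⟨s ∘ g, hs⟩
  · rintro X Y Z p g l (hp | hZ) hg
    · exact Or.inl (Surjective.of_comp hp)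
    · exact Or.inr (⟨fun x => hZ.false (l x)⟩)

theorem isWFS_isoNonEmpty :
    IsWFS.{u} (unionMaps IsoMaps NonEmptyMaps) (unionMaps IsoMaps EmptyMaps) := by
  refine isWFS_of_retract ?_ ?_ ?_ ?_
  · rintro A B X Y i p (hi | ⟨⟨a⟩⟩) hp
    · exact liftSq_of_bijective_left hi
    · rcases hp with hp | hX
      · exact liftSq_of_bijective_right hp
      · exact fun α => (hX.false (α a)).elim
  · intro X Y f
    rcases isEmpty_or_nonempty X with hX | hX
    · exact ⟨X, id, f, Or.inl bijective_id, Or.inr hX, rfl⟩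
    · exact ⟨Y, f, id, Or.inr hX, Or.inl bijective_id, rfl⟩
  · rintro A B Z i g r (hi | hA) hg
    · have hg' : Bijective g := ⟨injective_of_comp_eq_id hg, hi.2.of_comp⟩
      exact Or.inl ((Bijective.of_comp_iff' hg' i).1 hi)
    · exact Or.inr hA
  · rintro X Y Z p g l (hp | hZ) hg
    · have hg' : Bijective g := ⟨hp.1.of_comp, surjective_of_comp_eq_id hg⟩
      exact Or.inl ((Bijective.of_comp_iff p hg').1 hp)
    · exact Or.inr (⟨fun x => hZ.false (l x)⟩)

/-- The map from the empty set to a point. -/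
def emptyToPoint : PEmpty.{u + 1} → PUnit.{u + 1} := fun _ => PUnit.unit

/-- The map from the empty set to a two-element set. -/
def emptyToTwo : PEmpty.{u + 1} → ULift.{u} Bool := fun _ => ⟨true⟩

/-- The map from a two-element set to a point. -/
def twoToPoint : ULift.{u} Bool → PUnit.{u + 1} := fun _ => PUnit.unit

/-- An inclusion of a point into a two-element set. -/
def pointToTwo : PUnit.{u + 1} → ULift.{u} Bool := fun _ => ⟨true⟩

theorem surjective_of_liftSq_emptyToPoint {X Y : Type u} {p : X → Y}
    (h : LiftSq emptyToPoint p) : Surjective p := by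
  intro y
  obtain ⟨g, -, hg⟩ := h (fun x => x.elim) (fun _ => y) (funext fun x => x.elim)
  exact ⟨g PUnit.unit, congrFun hg PUnit.unit⟩

theorem injective_of_liftSq_twoToPoint {X Y : Type u} {p : X → Y}
    (h : LiftSq twoToPoint p) : Injective p := by
  intro x y hxy
  obtain ⟨g, hg, -⟩ := h (fun t => if t.down then x else y) (fun _ => p x)
    (funext fun t => by rcases t with ⟨_ | _⟩ <;> simp [hxy])
  have h1 := congrFun hg ⟨true⟩
  have h2 := congrFun hg ⟨false⟩
  simp only [comp_apply, twoToPoint, if_true, Bool.false_eq_true, if_false] at h1 h2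
  exact h1.symm.trans h2

theorem surjective_of_liftSq_pointToTwo {X Y : Type u} {p : X → Y}
    (h : LiftSq pointToTwo p) (x : X) : Surjective p := by
  intro y
  obtain ⟨g, -, hg⟩ := h (fun _ => x) (fun t => if t.down then p x else y)
    (funext fun _ => by simp [pointToTwo])
  exact ⟨g ⟨false⟩, by simpa using congrFun hg ⟨false⟩⟩

theorem LiftSq.of_isRetract {A B A' B' X Y : Type u} {i : A → B} {j : A' → B'} {p : X → Y}
    (hij : IsRetract i j) (h : LiftSq j p) : LiftSq i p := by
  obtain ⟨s, r, s', r', hr, hr', hs, hq⟩ := hij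
  intro α β hc
  obtain ⟨g, hg, hg'⟩ := h (α ∘ r) (β ∘ r') (by
    rw [← comp_assoc, hc, comp_assoc, comp_assoc, hq])
  refine ⟨g ∘ s', ?_, ?_⟩
  · rw [comp_assoc, ← hs, ← comp_assoc, hg, comp_assoc, hr, comp_id]
  · rw [← comp_assoc, hg', comp_assoc, hr', comp_id]

theorem IsWFS.left_of_isRetract {L R : MapClass.{u}} (h : IsWFS L R) {A B A' B' : Type u}
    {i : A → B} {j : A' → B'} (hij : IsRetract i j) (hj : L A' B' j) : L A B i :=
  (h.left_iff i).2 fun p hp => ((h.left_iff j).1 hj p hp).of_isRetract hij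

theorem isRetract_twoToPoint {A B : Type u} {f : A → B} (hf : ¬ Injective f) :
    IsRetract twoToPoint f := by
  classical
  simp only [Injective, not_forall] at hf
  obtain ⟨x, y, hxy, hne⟩ := hf
  refine ⟨fun t => if t.down then x else y, fun a => ⟨decide (a = x)⟩, fun _ => f x,
    fun _ => PUnit.unit, ?_, rfl, ?_, rfl⟩
  · funext t
    rcases t with ⟨_ | _⟩ <;> simp [Ne.symm hne]
  · funext t
    rcases t with ⟨_ | _⟩ <;> simp [hxy]

theorem isRetract_emptyToPoint {A B : Type u} [hA : IsEmpty A] [hB : Nonempty B] (f : A → B) :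
    IsRetract emptyToPoint f :=
  ⟨fun x => x.elim, fun a => isEmptyElim a, fun _ => Classical.arbitrary B,
    fun _ => PUnit.unit, funext fun x => x.elim, rfl, funext fun x => x.elim,
    funext fun a => isEmptyElim a⟩

theorem isRetract_pointToTwo {A B : Type u} [hA : Nonempty A] {f : A → B}
    (hf : ¬ Surjective f) : IsRetract pointToTwo f := by
  classical
  simp only [Surjective, not_forall] at hf
  obtain ⟨y, hy⟩ := hf
  obtain ⟨x⟩ := hA
  refine ⟨fun _ => x, fun _ => PUnit.unit, fun t => if t.down then f x else y,
    fun b => ⟨decide (∃ a, f a = b)⟩, rfl, ?_, ?_, ?_⟩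
  · funext t
    rcases t with ⟨_ | _⟩ <;> simp [not_exists.1 hy]
  · funext t
    simp [pointToTwo]
  · funext a
    simp [pointToTwo]

theorem IsWFS.left_eq {L R L' R' : MapClass.{u}} (h : IsWFS L R) (h' : IsWFS L' R')
    (hL : ∀ {A B : Type u} (i : A → B), L A B i → L' A B i)
    (hR : ∀ {X Y : Type u} (p : X → Y), R X Y p → R' X Y p) : L = L' ∧ R = R' := by
  have e : L = L' := by
    funext A B i
    exact propext ⟨hL i, fun hi => (h.left_iff i).2 fun p hp => (h'.left_iff i).1 hi p (hR p hp)⟩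
  subst e
  exact ⟨rfl, h.right_unique h'⟩

/-- The six weak factorization systems on the category of sets. -/
inductive StandardWFS : MapClass.{u} → MapClass.{u} → Prop
  | all_iso : StandardWFS AllMaps IsoMaps
  | iso_all : StandardWFS IsoMaps AllMaps
  | epi_mono : StandardWFS EpiMaps MonoMaps
  | mono_epi : StandardWFS MonoMaps EpiMaps
  | splitMono : StandardWFS SplitMonoMaps (unionMaps EpiMaps EmptyMaps)
  | isoNonEmpty : StandardWFS (unionMaps IsoMaps NonEmptyMaps) (unionMaps IsoMaps EmptyMaps)

theorem IsWFS.standard {L R : MapClass.{u}} (h : IsWFS L R) : StandardWFS L R := by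
  have lift {A B X Y : Type u} {i : A → B} {p : X → Y} (hi : L A B i) (hp : R X Y p) :
      LiftSq i p := (h.left_iff i).1 hi p hp
  have inj (hb : ¬ L _ _ twoToPoint) {A B : Type u} (f : A → B) (hf : L A B f) :
      Injective f := by
    by_contra hn
    exact hb (h.left_of_isRetract (isRetract_twoToPoint hn) hf)
  have emp (ha : ¬ L _ _ emptyToPoint) {A B : Type u} (f : A → B) (hf : L A B f)
      (hA : IsEmpty A) : IsEmpty B := by
    by_contra hn
    rw [not_isEmpty_iff] at hn
    exact ha (h.left_of_isRetract (isRetract_emptyToPoint f) hf)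
  have surj (ha : ¬ L _ _ emptyToPoint) (hc : ¬ L _ _ pointToTwo) {A B : Type u} (f : A → B)
      (hf : L A B f) : Surjective f := by
    rcases isEmpty_or_nonempty A with hA | hA
    · have := emp ha f hf hA
      exact fun y => isEmptyElim y
    · by_contra hn
      exact hc (h.left_of_isRetract (isRetract_pointToTwo hn) hf)
  by_cases ha : L _ _ emptyToPoint <;> by_cases hb : L _ _ twoToPoint
  · obtain ⟨rfl, rfl⟩ := h.left_eq isWFS_all_iso (fun _ _ => trivial) fun p hp =>
      ⟨injective_of_liftSq_twoToPoint (lift hb hp),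
        surjective_of_liftSq_emptyToPoint (lift ha hp)⟩
    exact .all_iso
  · obtain ⟨rfl, rfl⟩ := h.left_eq isWFS_mono_epi (inj hb) fun p hp =>
      surjective_of_liftSq_emptyToPoint (lift ha hp)
    exact .mono_epi
  · by_cases hc : L _ _ pointToTwo
    · obtain ⟨rfl, rfl⟩ := h.left_eq isWFS_isoNonEmpty
        (fun {A B} f hf => by
          rcases isEmpty_or_nonempty A with hA | hA
          · have := emp ha f hf hA
            exact Or.inl (bijective_of_isEmpty f)
          · exact Or.inr hA)
        (fun {X Y} p hp => by
          rcases isEmpty_or_nonempty X with hX | ⟨⟨x⟩⟩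
          · exact Or.inr hX
          · exact Or.inl ⟨injective_of_liftSq_twoToPoint (lift hb hp),
              surjective_of_liftSq_pointToTwo (lift hc hp) x⟩)
      exact .isoNonEmpty
    · obtain ⟨rfl, rfl⟩ := h.left_eq isWFS_epi_mono (surj ha hc) fun p hp =>
        injective_of_liftSq_twoToPoint (lift hb hp)
      exact .epi_mono
  · by_cases hc : L _ _ pointToTwo
    · obtain ⟨rfl, rfl⟩ := h.left_eq isWFS_splitMono
        (fun {A B} f hf => by
          rcases isEmpty_or_nonempty A with hA | hA
          · have := emp ha f hf hA
            exact ⟨fun b => isEmptyElim b, funext fun a => isEmptyElim a⟩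
          · exact ⟨invFun f, invFun_comp (inj hb f hf)⟩)
        (fun {X Y} p hp => by
          rcases isEmpty_or_nonempty X with hX | ⟨⟨x⟩⟩
          · exact Or.inr hX
          · exact Or.inl (surjective_of_liftSq_pointToTwo (lift hc hp) x))
      exact .splitMono
    · obtain ⟨rfl, rfl⟩ := h.left_eq isWFS_iso_all
        (fun f hf => ⟨inj hb f hf, surj ha hc f hf⟩) (fun _ _ => trivial)
      exact .iso_all

theorem StandardWFS.isWFS {L R : MapClass.{u}} (h : StandardWFS L R) : IsWFS L R := by
  cases h
  exacts [isWFS_all_iso, isWFS_iso_all, isWFS_epi_mono, isWFS_mono_epi, isWFS_splitMono,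
    isWFS_isoNonEmpty]

theorem injective_emptyToPoint : Injective emptyToPoint.{u} := fun x => x.elim

theorem injective_emptyToTwo : Injective emptyToTwo.{u} := fun x => x.elim

theorem injective_pointToTwo : Injective pointToTwo.{u} := fun _ _ _ => rfl

theorem surjective_twoToPoint : Surjective twoToPoint.{u} := fun _ => ⟨⟨true⟩, rfl⟩

theorem not_injective_twoToPoint : ¬ Injective twoToPoint.{u} := fun h => by
  simpa using @h ⟨true⟩ ⟨false⟩ rfl

theorem not_surjective_emptyToPoint : ¬ Surjective emptyToPoint.{u} := fun h =>
  (h PUnit.unit).choose.elim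

theorem not_surjective_emptyToTwo : ¬ Surjective emptyToTwo.{u} := fun h =>
  (h ⟨true⟩).choose.elim

theorem not_surjective_pointToTwo : ¬ Surjective pointToTwo.{u} := fun h => by
  obtain ⟨x, hx⟩ := h ⟨false⟩
  simp [pointToTwo] at hx

theorem splitMonoMaps_iff {X Y : Type u} (f : X → Y) :
    SplitMonoMaps X Y f ↔ Injective f ∧ (IsEmpty X → IsEmpty Y) := by
  constructor
  · rintro ⟨g, hg⟩
    exact ⟨injective_of_comp_eq_id hg, fun hX => ⟨fun y => hX.false (g y)⟩⟩
  · rintro ⟨hf, he⟩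
    rcases isEmpty_or_nonempty X with hX | hX
    · have := he hX
      exact ⟨fun b => isEmptyElim b, funext fun a => isEmptyElim a⟩
    · exact ⟨invFun f, invFun_comp hf⟩

theorem unionMaps_iso_nonEmpty_iff {X Y : Type u} (f : X → Y) :
    unionMaps IsoMaps NonEmptyMaps X Y f ↔ (Nonempty Y → Nonempty X) := by
  constructor
  · rintro (hf | hX) ⟨y⟩
    · exact ⟨(hf.2 y).choose⟩
    · exact hX
  · intro h
    rcases isEmpty_or_nonempty X with hX | hX
    · have : IsEmpty Y := not_nonempty_iff.1 fun hY => not_nonempty_iff.2 hX (h hY)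
      exact Or.inl (bijective_of_isEmpty f)
    · exact Or.inr hX

theorem IsModelStructure.of_standard {Cof Fib W L R : MapClass.{u}}
    (weq_retract : ∀ {X Y Z T : Type u} (f : X → Y) (g : Z → T),
      IsRetract f g → W Z T g → W X Y f)
    (weq_comp : ∀ {X Y Z : Type u} (f : X → Y) (g : Y → Z),
      W X Y f → W Y Z g → W X Z (g ∘ f))
    (weq_of_comp_left : ∀ {X Y Z : Type u} (f : X → Y) (g : Y → Z),
      W X Y f → W X Z (g ∘ f) → W Y Z g)
    (weq_of_comp_right : ∀ {X Y Z : Type u} (f : X → Y) (g : Y → Z),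
      W Y Z g → W X Z (g ∘ f) → W X Y f)
    (h₁ : StandardWFS L Fib) (h₂ : StandardWFS Cof R)
    (hL : ∀ {X Y : Type u} (f : X → Y), L X Y f ↔ Cof X Y f ∧ W X Y f)
    (hR : ∀ {X Y : Type u} (f : X → Y), R X Y f ↔ Fib X Y f ∧ W X Y f) :
    IsModelStructure Cof Fib W := by
  have eL : L = fun X Y f => Cof X Y f ∧ W X Y f := by
    funext X Y f
    exact propext (hL f)
  have eR : R = fun X Y f => Fib X Y f ∧ W X Y f := by
    funext X Y f
    exact propext (hR f)
  subst eL eR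
  exact ⟨weq_retract, weq_comp, weq_of_comp_left, weq_of_comp_right, h₁.isWFS, h₂.isWFS⟩

theorem StandardWFS.isModelStructure_all {L R : MapClass.{u}} (h : StandardWFS L R) :
    IsModelStructure L R AllMaps :=
  .of_standard (fun _ _ _ _ => trivial) (fun _ _ _ _ => trivial) (fun _ _ _ _ => trivial)
    (fun _ _ _ _ => trivial) h h (fun _ => (and_iff_left trivial).symm)
    (fun _ => (and_iff_left trivial).symm)

theorem isModelStructure_iso : IsModelStructure.{u} AllMaps AllMaps IsoMaps := by
  refine .of_standard ?_ ?_ ?_ ?_ .iso_all .all_iso (fun _ => (and_iff_right trivial).symm)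
    (fun _ => (and_iff_right trivial).symm)
  · intro X Y Z T f g hfg hg
    exact isWFS_iso_all.left_of_isRetract hfg hg
  · exact fun f g hf hg => hg.comp hf
  · exact fun f g hf hgf => (Bijective.of_comp_iff g hf).1 hgf
  · exact fun f g hg hgf => (Bijective.of_comp_iff' hg f).1 hgf

theorem isModelStructure_isoNonEmpty {Cof Fib L R : MapClass.{u}} (h₁ : StandardWFS L Fib)
    (h₂ : StandardWFS Cof R)
    (hL : ∀ {X Y : Type u} (f : X → Y),
      L X Y f ↔ Cof X Y f ∧ unionMaps IsoMaps NonEmptyMaps X Y f)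
    (hR : ∀ {X Y : Type u} (f : X → Y),
      R X Y f ↔ Fib X Y f ∧ unionMaps IsoMaps NonEmptyMaps X Y f) :
    IsModelStructure Cof Fib (unionMaps IsoMaps NonEmptyMaps) := by
  refine .of_standard ?_ ?_ ?_ ?_ h₁ h₂ hL hR
  · intro X Y Z T f g hfg hg
    exact isWFS_isoNonEmpty.left_of_isRetract hfg hg
  · intro X Y Z f g
    simp only [unionMaps_iso_nonEmpty_iff]
    exact fun hf hg => hf ∘ hg
  · intro X Y Z f g
    simp only [unionMaps_iso_nonEmpty_iff]
    exact fun _ hgf hZ => (hgf hZ).map f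
  · intro X Y Z f g
    simp only [unionMaps_iso_nonEmpty_iff]
    exact fun _ hgf hY => hgf (hY.map g)

theorem isModelStructure_all_isoEmpty : IsModelStructure.{u} AllMaps
    (unionMaps IsoMaps EmptyMaps) (unionMaps IsoMaps NonEmptyMaps) := by
  refine isModelStructure_isoNonEmpty .isoNonEmpty .all_iso
    (fun _ => (and_iff_right trivial).symm) fun {X Y} f => ⟨fun h => ⟨Or.inl h, Or.inl h⟩, ?_⟩
  rintro ⟨h | h, h' | h'⟩
  exacts [h, h, h', (not_nonempty_iff.2 h h').elim]

theorem isModelStructure_mono_epiEmpty : IsModelStructure.{u} MonoMaps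
    (unionMaps EpiMaps EmptyMaps) (unionMaps IsoMaps NonEmptyMaps) := by
  refine isModelStructure_isoNonEmpty .splitMono .mono_epi (fun {X Y} f => ?_)
    fun {X Y} f => ⟨fun h => ⟨Or.inl h, ?_⟩, ?_⟩
  · rw [splitMonoMaps_iff, unionMaps_iso_nonEmpty_iff, ← not_nonempty_iff, ← not_nonempty_iff,
      not_imp_not]
    rfl
  · rw [unionMaps_iso_nonEmpty_iff]
    exact fun ⟨y⟩ => ⟨(h y).choose⟩
  · rintro ⟨h | h, h' | h'⟩
    exacts [h, h, h'.2, (not_nonempty_iff.2 h h').elim]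

theorem IsModelStructure.weq_eq_all {Cof Fib W : MapClass.{u}} (h : IsModelStructure Cof Fib W)
    (e : (fun X Y f => Cof X Y f ∧ W X Y f) = Cof) : W = AllMaps := by
  have hwfs := h.wfs_trivCof_fib
  rw [e] at hwfs
  have eR := hwfs.right_unique h.wfs_cof_trivFib
  funext X Y f
  refine propext ⟨fun _ => trivial, fun _ => ?_⟩
  obtain ⟨Z, l, r, hl, hr, rfl⟩ := h.wfs_trivCof_fib.factor f
  rw [eR] at hr
  exact h.weq_comp l r hl.2 hr.2

theorem eq_of_allMaps_and_eq {W L : MapClass.{u}}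
    (e : (fun X Y f => AllMaps X Y f ∧ W X Y f) = L) : W = L := by
  subst e
  funext X Y f
  exact propext (and_iff_right trivial).symm

theorem IsModelStructure.weq_id {Cof Fib W : MapClass.{u}} (h : IsModelStructure Cof Fib W)
    (X : Type u) : W X X id := by
  obtain ⟨Z, l, r, hl, -, hf⟩ := h.wfs_trivCof_fib.factor (id : X → X)
  exact h.weq_retract id l ⟨id, id, l, r, rfl, hf, rfl, hf⟩ hl.2

/-- Two nested weak factorization systems whose classes are cut out by a class `W` satisfying
two-out-of-three on the four test maps either agree or are one of three exceptional pairs. -/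
theorem StandardWFS.pair_cases {Cof Fib W L R : MapClass.{u}} (h₁ : StandardWFS L Fib)
    (h₂ : StandardWFS Cof R) (hL : ∀ {X Y : Type u} (f : X → Y), L X Y f ↔ Cof X Y f ∧ W X Y f)
    (hR : ∀ {X Y : Type u} (f : X → Y), R X Y f ↔ Fib X Y f ∧ W X Y f)
    (hbc : W _ _ twoToPoint ↔ W _ _ pointToTwo)
    (hac : W _ _ emptyToPoint → (W _ _ emptyToTwo ↔ W _ _ pointToTwo)) :
    L = Cof ∨ (Cof = AllMaps ∧ L = IsoMaps ∧ Fib = AllMaps) ∨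
      (Cof = AllMaps ∧ L = unionMaps IsoMaps NonEmptyMaps ∧
        Fib = unionMaps IsoMaps EmptyMaps) ∨
      (Cof = MonoMaps ∧ L = SplitMonoMaps ∧ Fib = unionMaps EpiMaps EmptyMaps ∧
        R = EpiMaps) := by
  have La := hL emptyToPoint
  have Lb := hL twoToPoint
  have Lc := hL pointToTwo
  have Ra := hR emptyToPoint
  have Rb := hR twoToPoint
  have Rc := hR pointToTwo
  have Rd := hR emptyToTwo
  have hE : IsEmpty PEmpty.{u + 1} := inferInstance
  clear hL hR
  generalize W _ _ emptyToPoint = wa at *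
  generalize W _ _ twoToPoint = wb at *
  generalize W _ _ pointToTwo = wc at *
  generalize W _ _ emptyToTwo = wd at *
  cases h₁ <;> cases h₂
  all_goals
    first
    | exact Or.inl rfl
    | exact Or.inr (Or.inl ⟨rfl, rfl, rfl⟩)
    | exact Or.inr (Or.inr (Or.inl ⟨rfl, rfl, rfl⟩))
    | exact Or.inr (Or.inr (Or.inr ⟨rfl, rfl, rfl, rfl⟩))
    | exfalso
      simp [AllMaps, IsoMaps, EpiMaps, MonoMaps, unionMaps, NonEmptyMaps, EmptyMaps,
        splitMonoMaps_iff, Bijective, injective_emptyToPoint, injective_emptyToTwo,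
        injective_pointToTwo, surjective_twoToPoint, not_injective_twoToPoint,
        not_surjective_emptyToPoint, not_surjective_emptyToTwo,
        not_surjective_pointToTwo, hE] at La Lb Lc Ra Rb Rc Rd <;> grind

theorem IsModelStructure.weq_of_mono {W : MapClass.{u}}
    (h : IsModelStructure MonoMaps (unionMaps EpiMaps EmptyMaps) W)
    (eL : SplitMonoMaps = fun X Y f => MonoMaps X Y f ∧ W X Y f)
    (eR : EpiMaps = fun X Y f => unionMaps EpiMaps EmptyMaps X Y f ∧ W X Y f) :
    W = unionMaps IsoMaps NonEmptyMaps := by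
  have hS {X Y : Type u} (f : X → Y) : SplitMonoMaps X Y f ↔ Injective f ∧ W X Y f := by
    rw [eL]
    rfl
  have hE {X Y : Type u} (f : X → Y) (hf : Surjective f) : W X Y f := by
    have : EpiMaps X Y f := hf
    rw [eR] at this
    exact this.2
  funext X Y f
  refine propext ⟨fun hf => ?_, ?_⟩
  · rcases isEmpty_or_nonempty X with hX | hX
    · have := ((splitMonoMaps_iff f).1
        ((hS f).2 ⟨injective_of_subsingleton f, hf⟩)).2 hX
      exact Or.inl (bijective_of_isEmpty f)
    · exact Or.inr hX
  · rintro (hf | ⟨⟨x⟩⟩)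
    · exact hE f hf.2
    · obtain ⟨Z, l, r, hl, hr | hZ, rfl⟩ := isWFS_splitMono.factor f
      · exact h.weq_comp l r ((hS l).1 hl).2 (hE r hr)
      · exact (hZ.false (l x)).elim

/-- The nine model structures on the category of sets. -/
theorem model_structure_classification_of_set (Cof Fib W : MapClass.{u}) :
    IsModelStructure Cof Fib W ↔
      ((Cof = AllMaps ∧ Fib = AllMaps ∧ W = IsoMaps) ∨
       (Cof = AllMaps ∧ Fib = unionMaps IsoMaps EmptyMaps ∧
          W = unionMaps IsoMaps NonEmptyMaps) ∨
       (Cof = AllMaps ∧ Fib = IsoMaps ∧ W = AllMaps) ∨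
       (Cof = IsoMaps ∧ Fib = AllMaps ∧ W = AllMaps) ∨
       (Cof = EpiMaps ∧ Fib = MonoMaps ∧ W = AllMaps) ∨
       (Cof = MonoMaps ∧ Fib = EpiMaps ∧ W = AllMaps) ∨
       (Cof = SplitMonoMaps ∧ Fib = unionMaps EpiMaps EmptyMaps ∧ W = AllMaps) ∨
       (Cof = unionMaps IsoMaps NonEmptyMaps ∧ Fib = unionMaps IsoMaps EmptyMaps ∧
          W = AllMaps) ∨
       (Cof = MonoMaps ∧ Fib = unionMaps EpiMaps EmptyMaps ∧
          W = unionMaps IsoMaps NonEmptyMaps)) := by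
  constructor
  · intro h
    obtain ⟨L, hL⟩ : ∃ L : MapClass.{u}, L = fun X Y f => Cof X Y f ∧ W X Y f := ⟨_, rfl⟩
    obtain ⟨R, hR⟩ : ∃ R : MapClass.{u}, R = fun X Y f => Fib X Y f ∧ W X Y f := ⟨_, rfl⟩
    have h₁ : StandardWFS L Fib := hL ▸ h.wfs_trivCof_fib.standard
    have h₂ : StandardWFS Cof R := hR ▸ h.wfs_cof_trivFib.standard
    have hid : W _ _ (id : PUnit.{u + 1} → PUnit.{u + 1}) := h.weq_id PUnit
    have hcases := h₁.pair_cases (W := W) h₂ (fun f => by rw [hL]) (fun f => by rw [hR])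
      ⟨fun hb => h.weq_of_comp_right pointToTwo twoToPoint hb hid,
        fun hc => h.weq_of_comp_left pointToTwo twoToPoint hc hid⟩
      fun ha => ⟨fun hd => h.weq_of_comp_left emptyToPoint pointToTwo ha hd,
        fun hc => h.weq_comp emptyToPoint pointToTwo ha hc⟩
    rcases hcases with e | ⟨rfl, rfl, rfl⟩ | ⟨rfl, rfl, rfl⟩ | ⟨rfl, rfl, rfl, rfl⟩
    · obtain rfl := h.weq_eq_all (hL.symm.trans e)
      subst e
      cases h₁ <;> simp
    · obtain rfl := eq_of_allMaps_and_eq hL.symm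
      simp
    · obtain rfl := eq_of_allMaps_and_eq hL.symm
      simp
    · obtain rfl := h.weq_of_mono hL hR
      simp
  · rintro (⟨rfl, rfl, rfl⟩ | ⟨rfl, rfl, rfl⟩ | ⟨rfl, rfl, rfl⟩ | ⟨rfl, rfl, rfl⟩ |
      ⟨rfl, rfl, rfl⟩ | ⟨rfl, rfl, rfl⟩ | ⟨rfl, rfl, rfl⟩ | ⟨rfl, rfl, rfl⟩ | ⟨rfl, rfl, rfl⟩)
    exacts [isModelStructure_iso, isModelStructure_all_isoEmpty,
      StandardWFS.all_iso.isModelStructure_all, StandardWFS.iso_all.isModelStructure_all,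
      StandardWFS.epi_mono.isModelStructure_all, StandardWFS.mono_epi.isModelStructure_all,
      StandardWFS.splitMono.isModelStructure_all, StandardWFS.isoNonEmpty.isModelStructure_all,
      isModelStructure_mono_epiEmpty]
end

section
/- For any set K of morphisms of the category Set of sets, the class cof(K) is exactly the class of retracts (in the arrow category) of transfinite compositions of pushouts of elements of K. -/
universe u

/-- `inj(K)`: the class of set maps having the RLP with respect to every member of the
set of maps `K`, given as a family indexed by a (small) index type `ι`. -/
def injF {ι : Type u} {A B : ι → Type u} (k : ∀ i, A i → B i) : MapClass.{u} :=
  fun X Y p => ∀ i, LiftSq (k i) p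

/-- `cof(K)`: the class of set maps having the LLP with respect to every member of
`inj(K)`. -/
def cofF {ι : Type u} {A B : ι → Type u} (k : ∀ i, A i → B i) : MapClass.{u} :=
  fun X Y f => ∀ {Z T : Type u} (p : Z → T), injF k Z T p → LiftSq f p

/-- `f` is a pushout of some member of the family `k`: there is a pushout square
whose left side is some `k i` and whose right side is `f`. -/
def IsPushoutOf {ι : Type u} {A B : ι → Type u} (k : ∀ i, A i → B i)
    {X Y : Type u} (f : X → Y) : Prop :=
  ∃ (i : ι) (a : A i → X) (b : B i → Y),
    f ∘ a = b ∘ k i ∧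
    ∀ {Z : Type u} (u : X → Z) (v : B i → Z), u ∘ a = v ∘ k i →
      ∃! w : Y → Z, w ∘ f = u ∧ w ∘ b = v

/-- A witness that `f : X → Y` is a transfinite composition of morphisms belonging to
`P`: a colimit-preserving sequence indexed by a well-ordered set `J` (with bottom and
top), each successor (covering) step lying in `P`, each limit stage being the colimit
of the preceding stages, whose composite from bottom to top is `f` (up to bijections
at the two ends). -/
structure TransfiniteCompositionWitness (P : MapClass.{u}) {X Y : Type u} (f : X → Y) :
    Type (u + 1) where
  J : Type u
  [linOrd : LinearOrder J]
  [orderBot : OrderBot J]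
  [orderTop : OrderTop J]
  [wf : WellFoundedLT J]
  F : J → Type u
  map : ∀ {i j : J}, i ≤ j → F i → F j
  map_id : ∀ i : J, map (le_refl i) = id
  map_comp : ∀ (i j l : J) (hij : i ≤ j) (hjl : j ≤ l),
    map hjl ∘ map hij = map (hij.trans hjl)
  succ_step : ∀ (i j : J) (h : i ⋖ j), P (F i) (F j) (map h.le)
  limit_step : ∀ j : J, j ≠ ⊥ → (∀ i, ¬ i ⋖ j) →
    ∀ (Z : Type u) (c : ∀ i, i < j → (F i → Z)),
      (∀ (i₁ i₂ : J) (h₁ : i₁ < j) (h₂ : i₂ < j) (h : i₁ ≤ i₂), c i₂ h₂ ∘ map h = c i₁ h₁) →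
      ∃! w : F j → Z, ∀ (i : J) (h : i < j), w ∘ map h.le = c i h
  e₀ : X ≃ F ⊥
  e₁ : F ⊤ ≃ Y
  fac : ⇑e₁ ∘ map bot_le ∘ ⇑e₀ = f

/-- `f` is a transfinite composition of morphisms belonging to `P`. -/
def IsTransfiniteCompositionOf (P : MapClass.{u}) {X Y : Type u} (f : X → Y) : Prop :=
  Nonempty (TransfiniteCompositionWitness P f)

section AttachCells

variable {S X : Type u} {A B : S → Type u}

/-- The relation gluing the cells `k s : A s → B s`, for `s ∈ P`, to `X` along the
attaching maps `a s : A s → X`. -/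
inductive CellRel (k : ∀ s, A s → B s) (a : ∀ s, A s → X) (P : Set S) :
    X ⊕ (Σ s : P, B s) → X ⊕ (Σ s : P, B s) → Prop
  | glue (s : S) (hs : s ∈ P) (x : A s) :
      CellRel k a P (Sum.inl (a s x)) (Sum.inr ⟨⟨s, hs⟩, k s x⟩)

/-- The pushout of `X` along the coproduct of the cells `k s`, for `s ∈ P`. -/
def AttachCells (k : ∀ s, A s → B s) (a : ∀ s, A s → X) (P : Set S) : Type u :=
  Quot (CellRel k a P)

namespace AttachCells

variable (k : ∀ s, A s → B s) (a : ∀ s, A s → X) {P Q R : Set S}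

/-- The inclusion of the base. -/
def base (P : Set S) (x : X) : AttachCells k a P := Quot.mk _ (Sum.inl x)

/-- The inclusion of a cell. -/
def cell {P : Set S} (s : S) (hs : s ∈ P) (b : B s) : AttachCells k a P :=
  Quot.mk _ (Sum.inr ⟨⟨s, hs⟩, b⟩)

lemma base_attach (s : S) (hs : s ∈ P) (x : A s) :
    base k a P (a s x) = cell k a s hs (k s x) :=
  Quot.sound (CellRel.glue s hs x)

variable {k a}

/-- The universal property of the pushout. -/
def desc {Z : Type*} (u : X → Z) (v : ∀ s ∈ P, B s → Z)
    (h : ∀ s hs x, u (a s x) = v s hs (k s x)) : AttachCells k a P → Z :=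
  Quot.lift (Sum.elim u fun c => v c.1.1 c.1.2 c.2) fun _ _ hr => by
    cases hr with
    | glue s hs x => exact h s hs x

lemma hom_ext {Z : Type*} {f g : AttachCells k a P → Z}
    (h₁ : ∀ x, f (base k a P x) = g (base k a P x))
    (h₂ : ∀ s hs b, f (cell k a s hs b) = g (cell k a s hs b)) : f = g := by
  funext z
  induction z using Quot.ind with
  | mk z =>
    rcases z with x | ⟨⟨s, hs⟩, b⟩
    · exact h₁ x
    · exact h₂ s hs b

/-- Attaching fewer cells maps to attaching more cells. -/
def map (h : P ⊆ Q) : AttachCells k a P → AttachCells k a Q :=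
  desc (base k a Q) (fun s hs => cell k a s (h hs)) fun s hs => base_attach k a s (h hs)

lemma map_refl (h : P ⊆ P) : map (k := k) (a := a) h = id :=
  hom_ext (fun _ => rfl) fun _ _ _ => rfl

lemma map_comp_map (h : P ⊆ Q) (h' : Q ⊆ R) :
    map (k := k) (a := a) h' ∘ map h = map (h.trans h') :=
  hom_ext (fun _ => rfl) fun _ _ _ => rfl

/-- Attaching one more cell `s` is a pushout of `k s`. -/
lemma isPushout_map_of_forall_mem (h : P ⊆ Q) (s : S) (hs : s ∈ Q)
    (hQ : ∀ t ∈ Q, t ∉ P → t = s) (hsP : s ∉ P) {Z : Type*}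
    (u : AttachCells k a P → Z) (v : B s → Z)
    (huv : u ∘ base k a P ∘ a s = v ∘ k s) :
    ∃! w : AttachCells k a Q → Z, w ∘ map h = u ∧ w ∘ cell k a s hs = v := by
  classical
  have key : ∀ t ∈ Q, ∃ v' : B t → Z, (∀ x, u (base k a P (a t x)) = v' (k t x)) ∧
      (∀ ht : t ∈ P, ∀ b, v' b = u (cell k a t ht b)) ∧
      ∀ e : t = s, ∀ b, v' b = v (e ▸ b) := by
    intro t ht
    by_cases htP : t ∈ P
    · exact ⟨fun b => u (cell k a t htP b),
        fun x => congrArg u (base_attach k a t htP x), fun _ _ => rfl,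
        fun e => absurd (e ▸ htP) hsP⟩
    · obtain rfl := hQ t ht htP
      exact ⟨v, congrFun huv, fun h => absurd h htP, fun _ _ => rfl⟩
  choose v' hv₁ hv₂ hv₃ using key
  refine ⟨desc (u ∘ base k a P) v' hv₁, ⟨hom_ext (fun _ => rfl) fun t ht b =>
    hv₂ t (h ht) ht b, funext fun b => hv₃ s hs rfl b⟩, ?_⟩
  rintro w ⟨rfl, rfl⟩
  refine hom_ext (fun _ => rfl) fun t ht b => ?_
  by_cases htP : t ∈ P
  · exact (hv₂ t ht htP b).symm
  · obtain rfl := hQ t ht htP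
    exact (hv₃ t ht rfl b).symm

/-- A directed union of sets of cells is a colimit. -/
lemma existsUnique_desc_of_iUnion {J : Type*} [LinearOrder J] {j : J} (P : J → Set S)
    (hP : Monotone P) (hj : ∃ i, i < j) (hcov : ∀ s ∈ P j, ∃ i < j, s ∈ P i) {Z : Type*}
    (c : ∀ i, i < j → AttachCells k a (P i) → Z)
    (hc : ∀ i₁ i₂ (_ : i₁ < j) (h₂ : i₂ < j) (h : i₁ ≤ i₂),
      c i₂ h₂ ∘ map (hP h) = c i₁ (h.trans_lt h₂)) :
    ∃! w : AttachCells k a (P j) → Z, ∀ i (h : i < j), w ∘ map (hP h.le) = c i h := by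
  obtain ⟨i₀, hi₀⟩ := hj
  have base_eq : ∀ i h i' h' x,
      c i h (base k a (P i) x) = c i' h' (base k a (P i') x) := by
    intro i h i' h' x
    rcases le_total i i' with hle | hle
    · exact (congrFun (hc i i' h h' hle) (base k a (P i) x)).symm
    · exact congrFun (hc i' i h' h hle) (base k a (P i') x)
  have cell_eq : ∀ i h i' h' s hs hs' b,
      c i h (cell k a s hs b) = c i' h' (cell k a s hs' b) := by
    intro i h i' h' s hs hs' b
    rcases le_total i i' with hle | hle
    · exact (congrFun (hc i i' h h' hle) (cell k a s hs b)).symm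
    · exact congrFun (hc i' i h' h hle) (cell k a s hs' b)
  choose r hr hrP using hcov
  refine ⟨desc (fun x => c i₀ hi₀ (base k a _ x))
    (fun s hs b => c (r s hs) (hr s hs) (cell k a s (hrP s hs) b))
    (fun s hs x => ?_), fun i h => hom_ext (fun x => base_eq _ _ _ _ x)
      fun s hs b => cell_eq _ _ _ _ s _ _ b, fun w hw => ?_⟩
  · rw [← base_attach]
    exact base_eq _ _ _ _ _
  · exact hom_ext (fun x => congrFun (hw i₀ hi₀) (base k a _ x))
      fun s hs b => congrFun (hw _ (hr s hs)) (cell k a s (hrP s hs) b)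

end AttachCells

end AttachCells

/-- A pushout of a coproduct of members of a family is a transfinite composition of pushouts
of members of the family. -/
lemma isTransfiniteCompositionOf_base {ι : Type u} {A B : ι → Type u} (k : ∀ i, A i → B i)
    {S X : Type u} (c : S → ι) (a : ∀ s, A (c s) → X) :
    IsTransfiniteCompositionOf (fun Z' T' (g' : Z' → T') => IsPushoutOf k g')
      (AttachCells.base (fun s => k (c s)) a Set.univ) := by
  classical
  obtain ⟨_, _⟩ := exists_wellFoundedLT S
  let : OrderBot (WithTop S) := WellFoundedLT.toOrderBot _
  let P : WithTop S → Set S := fun j => {s | (s : WithTop S) < j}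
  have hP : Monotone P := fun i j h s hs => lt_of_lt_of_le hs h
  have hbot : ∀ s, s ∉ P ⊥ := fun s (hs : (s : WithTop S) < ⊥) => not_lt_bot hs
  have htop : Set.univ ⊆ P ⊤ := fun s _ => WithTop.coe_lt_top s
  refine ⟨{
    J := WithTop S
    F := fun j => AttachCells (fun s => k (c s)) a (P j)
    map := fun h => AttachCells.map (hP h)
    map_id := fun i => AttachCells.map_refl _
    map_comp := fun i j l hij hjl => AttachCells.map_comp_map _ _
    succ_step := ?_
    limit_step := ?_
    e₀ := ⟨AttachCells.base _ a _, AttachCells.desc id (fun s hs => absurd hs (hbot s))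
      (fun s hs => absurd hs (hbot s)), fun _ => rfl, congrFun
        (AttachCells.hom_ext (f := AttachCells.base _ a _ ∘ AttachCells.desc id _ _) (g := id)
          (fun _ => rfl) fun s hs => absurd hs (hbot s))⟩
    e₁ := ⟨AttachCells.map (Set.subset_univ _), AttachCells.map htop,
      congrFun ((AttachCells.map_comp_map _ _).trans (AttachCells.map_refl _)),
      congrFun ((AttachCells.map_comp_map _ _).trans (AttachCells.map_refl _))⟩
    fac := rfl }⟩
  · intro i j h
    obtain ⟨s, rfl⟩ := WithTop.ne_top_iff_exists.mp h.lt.ne_top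
    have hs : s ∈ P j := h.lt
    refine ⟨c s, AttachCells.base _ a _ ∘ a s, AttachCells.cell (fun s => k (c s)) a s hs,
      funext fun x => AttachCells.base_attach (fun s => k (c s)) a s hs x, fun u v huv => ?_⟩
    refine AttachCells.isPushout_map_of_forall_mem (k := fun s => k (c s)) (hP h.le) s hs
      (fun t ht htP => ?_) (lt_irrefl (s : WithTop S)) u v huv
    have h₁ : (s : WithTop S) ≤ t := not_lt.mp htP
    exact (WithTop.coe_injective (h₁.eq_of_not_lt fun h' => h.2 h' ht)).symm
  · intro j hj hlim Z d hd
    refine AttachCells.existsUnique_desc_of_iUnion P hP ⟨⊥, bot_lt_iff_ne_bot.mpr hj⟩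
      (fun s hs => ?_) d fun i₁ i₂ h₁ h₂ h => hd i₁ i₂ h₁ h₂ h
    by_contra! hcon
    exact hlim s ⟨hs, fun i h₁ h₂ => hcon i h₂ h₁⟩

/-- The coproduct of all lifting problems of the family `k` against `f`. -/
abbrev LiftingProblem {ι : Type u} {A B : ι → Type u} (k : ∀ i, A i → B i) {X Y : Type u}
    (f : X → Y) : Type u :=
  Σ i, {ab : (A i → X) × (B i → Y) // f ∘ ab.1 = ab.2 ∘ k i}

/-- A member `f` of `cof(K)` is a retract of the map attaching a cell for every lifting problem
against `f`. In the category of sets one such step suffices. -/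
lemma cofF.isRetract_base {ι : Type u} {A B : ι → Type u} {k : ∀ i, A i → B i}
    {X Y : Type u} {f : X → Y} (hf : cofF k X Y f) :
    IsRetract f (AttachCells.base (fun s : LiftingProblem k f => k s.1) (fun s => s.2.1.1)
      Set.univ) := by
  classical
  set g := AttachCells.base (fun s : LiftingProblem k f => k s.1) (fun s => s.2.1.1)
      Set.univ
  let q : AttachCells (fun s : LiftingProblem k f => k s.1) (fun s => s.2.1.1) Set.univ → Y :=
    AttachCells.desc f (fun s _ => s.2.1.2) fun s _ => congrFun s.2.2
  have hker : ∀ x x', f x = f x' → g x = g x' := by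
    intro x x' hxx'
    by_contra hne
    have hinj : ¬ injF k X PUnit (fun _ => PUnit.unit) := by
      intro h
      obtain ⟨l, hl, -⟩ := hf _ h id (fun _ => PUnit.unit) rfl
      have := congrArg l hxx'
      rw [← Function.comp_apply (f := l), ← Function.comp_apply (f := l), hl] at this
      exact hne (congrArg g this)
    refine hinj fun i α β _ => ?_
    have hα : α.FactorsThrough (k i) := by
      intro v w hvw
      by_contra hvw'
      have hvw'' : v ≠ w := fun h => hvw' (congrArg α h)
      let s : LiftingProblem k f := ⟨i, ⟨(fun z => if z = w then x' else x, fun _ => f x), by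
        funext z
        by_cases hz : z = w <;> simp [hz, hxx']⟩⟩
      have h₁ := AttachCells.base_attach (fun s : LiftingProblem k f => k s.1)
        (fun s => s.2.1.1) s (Set.mem_univ s) v
      have h₂ := AttachCells.base_attach (fun s : LiftingProblem k f => k s.1)
        (fun s => s.2.1.1) s (Set.mem_univ s) w
      have h₃ : s.2.1.1 v = x := if_neg hvw''
      have h₄ : s.2.1.1 w = x' := if_pos rfl
      rw [h₃] at h₁
      rw [h₄] at h₂
      exact hne (h₁.trans ((congrArg _ hvw).trans h₂.symm))
    exact ⟨Function.extend (k i) α fun _ => x, funext fun v => hα.extend_apply _ v,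
      rfl⟩
  have hsurj : Function.Surjective q := by
    intro y
    by_contra! hy
    have hinj : ¬ injF k (Set.range f) Y Subtype.val := by
      intro h
      obtain ⟨l, -, hl⟩ := hf _ h (Set.rangeFactorization f) id rfl
      obtain ⟨x, hx⟩ := (l y).2
      exact hy (g x) (hx.trans (congrFun hl y))
    refine hinj fun i α β hαβ => ?_
    have hβ : ∀ b, β b ∈ Set.range f := by
      intro b
      by_contra hb
      choose a ha using fun z => (α z).2
      let s : LiftingProblem k f := ⟨i, ⟨(a, Function.update β b y), by
        funext z
        have hz : k i z ≠ b := by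
          rintro rfl
          exact hb ⟨a z, (ha z).trans (congrFun hαβ z)⟩
        simpa [hz] using (ha z).trans (congrFun hαβ z)⟩⟩
      have hqb : q (AttachCells.cell _ _ s (Set.mem_univ s) b) = Function.update β b y b := rfl
      exact hy _ (hqb.trans (Function.update_self b y β))
    exact ⟨fun b => ⟨β b, hβ b⟩, funext fun z => Subtype.ext (congrFun hαβ z).symm, rfl⟩
  have hfac : g.FactorsThrough f := fun x x' h => hker x x' h
  refine ⟨id, id, Function.extend f g (Function.surjInv hsurj), q, rfl, funext fun y => ?_,
    funext fun x => (hfac.extend_apply _ x).symm, rfl⟩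
  by_cases hy : ∃ x, f x = y
  · obtain ⟨x, rfl⟩ := hy
    exact congrArg q (hfac.extend_apply _ x)
  · exact (congrArg q (Function.extend_apply' g _ y hy)).trans (Function.surjInv_eq hsurj y)

lemma LiftSq.of_isRetract_s3 {X Y Z W E D : Type u} {f : X → Y} {g : Z → W} {p : E → D}
    (hg : LiftSq g p) (h : IsRetract f g) : LiftSq f p := by
  obtain ⟨i, r, j, q, hri, hqj, hgi, hqg⟩ := h
  intro α β hαβ
  obtain ⟨l, hl₁, hl₂⟩ := hg (α ∘ r) (β ∘ q) (by
    rw [← Function.comp_assoc, hαβ, Function.comp_assoc, Function.comp_assoc, hqg])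
  refine ⟨l ∘ j, ?_, ?_⟩
  · rw [Function.comp_assoc, ← hgi, ← Function.comp_assoc, hl₁, Function.comp_assoc, hri,
      Function.comp_id]
  · rw [← Function.comp_assoc, hl₂, Function.comp_assoc, hqj, Function.comp_id]

lemma LiftSq.of_isPushoutOf {ι : Type u} {A B : ι → Type u} {k : ∀ i, A i → B i}
    {X Y E D : Type u} {f : X → Y} {p : E → D} (hp : injF k E D p) (hf : IsPushoutOf k f) :
    LiftSq f p := by
  obtain ⟨i, a, b, hab, huniv⟩ := hf
  intro α β hαβ
  obtain ⟨l, hl₁, hl₂⟩ := hp i (α ∘ a) (β ∘ b) (by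
    rw [← Function.comp_assoc, hαβ, Function.comp_assoc, Function.comp_assoc, hab])
  obtain ⟨w, ⟨hw₁, hw₂⟩, -⟩ := huniv α l hl₁.symm
  refine ⟨w, hw₁, (huniv (p ∘ α) (p ∘ l) (congrArg (p ∘ ·) hl₁.symm)).unique
    ⟨congrArg (p ∘ ·) hw₁, congrArg (p ∘ ·) hw₂⟩ ⟨hαβ.symm, hl₂.symm⟩⟩

namespace TransfiniteCompositionWitness

variable {P : MapClass.{u}} {X Y : Type u} {f : X → Y}

attribute [instance] linOrd orderBot orderTop wf

/-- Lifts at stage `j` of the map `β` along `p`. -/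
abbrev Lift (w : TransfiniteCompositionWitness P f) {E D : Type u} (p : E → D)
    (β : w.F ⊤ → D) (j : w.J) : Type u :=
  {l : w.F j → E // p ∘ l = β ∘ w.map le_top}

/-- Restriction of lifts to an earlier stage. -/
def Lift.res {w : TransfiniteCompositionWitness P f} {E D : Type u} {p : E → D}
    {β : w.F ⊤ → D} {i j : w.J} (l : w.Lift p β j) (h : i ≤ j) : w.Lift p β i :=
  ⟨l.1 ∘ w.map h, by
    rw [← Function.comp_assoc, l.2, Function.comp_assoc, w.map_comp]⟩

lemma Lift.res_res {w : TransfiniteCompositionWitness P f} {E D : Type u} {p : E → D}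
    {β : w.F ⊤ → D} {i j m : w.J} (l : w.Lift p β m) (h : i ≤ j) (h' : j ≤ m) :
    (l.res h').res h = l.res (h.trans h') :=
  Subtype.ext (by simp only [Lift.res, Function.comp_assoc, w.map_comp])

lemma Lift.res_refl {w : TransfiniteCompositionWitness P f} {E D : Type u} {p : E → D}
    {β : w.F ⊤ → D} {j : w.J} (l : w.Lift p β j) (h : j ≤ j) : l.res h = l :=
  Subtype.ext (by simp only [Lift.res, w.map_id, Function.comp_id])

/-- A lift at stage `j` which starts with `l₀` and follows the chosen extensions `ext` at all
successor steps. -/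
def IsCoherent (w : TransfiniteCompositionWitness P f) {E D : Type u} {p : E → D}
    {β : w.F ⊤ → D} (l₀ : w.Lift p β ⊥)
    (ext : ∀ i j : w.J, i ⋖ j → w.Lift p β i → w.Lift p β j) {j : w.J}
    (l : w.Lift p β j) : Prop :=
  l.res bot_le = l₀ ∧
    ∀ (i i' : w.J) (h : i ⋖ i') (h' : i' ≤ j), l.res h' = ext i i' h (l.res (h.le.trans h'))

section

variable {w : TransfiniteCompositionWitness P f} {E D : Type u} {p : E → D}
    {β : w.F ⊤ → D} {l₀ : w.Lift p β ⊥}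
    {ext : ∀ i j : w.J, i ⋖ j → w.Lift p β i → w.Lift p β j}

lemma IsCoherent.res {i j : w.J} {l : w.Lift p β j} (hl : w.IsCoherent l₀ ext l) (h : i ≤ j) :
    w.IsCoherent l₀ ext (l.res h) :=
  ⟨(l.res_res _ _).trans hl.1, fun m m' hm hm' => by
    simpa only [Lift.res_res] using hl.2 m m' hm (hm'.trans h)⟩

lemma existsUnique_isCoherent
    (hext : ∀ i j (h : i ⋖ j) (l : w.Lift p β i), (ext i j h l).res h.le = l) (j : w.J) :
    ∃! l : w.Lift p β j, w.IsCoherent l₀ ext l := by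
  induction j using WellFoundedLT.induction with
  | ind j ih =>
    by_cases hj : j = ⊥
    · subst hj
      refine ⟨l₀, ⟨l₀.res_refl _, fun i i' h h' =>
        absurd (h.lt.trans_le h') not_lt_bot⟩, fun l hl => ?_⟩
      rw [← hl.1, Lift.res_refl]
    by_cases hs : ∃ i, i ⋖ j
    · obtain ⟨i, hij⟩ := hs
      obtain ⟨l, hl, hlu⟩ := ih i hij.lt
      refine ⟨ext i j hij l, ⟨?_, fun m m' hm hm' => ?_⟩, fun l' hl' => ?_⟩
      · rw [← Lift.res_res _ bot_le hij.le, hext, hl.1]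
      · rcases hm'.eq_or_lt with rfl | hlt
        · obtain rfl : m = i := hm.unique_left hij
          rw [Lift.res_refl, hext]
        · have hle : m' ≤ i := le_of_not_gt fun h => hij.2 h hlt
          rw [← Lift.res_res _ hle hij.le, ← Lift.res_res _ (hm.le.trans hle) hij.le, hext]
          exact hl.2 m m' hm hle
      · have := hl'.2 i j hij le_rfl
        rw [Lift.res_refl, hlu _ (hl'.res _)] at this
        exact this
    · have hlim : ∀ i, ¬ i ⋖ j := fun i h => hs ⟨i, h⟩
      choose c hc hcu using ih
      have hcc : ∀ (i₁ i₂ : w.J) (h₁ : i₁ < j) (h₂ : i₂ < j) (h : i₁ ≤ i₂),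
          (c i₂ h₂).res h = c i₁ h₁ := fun i₁ i₂ h₁ h₂ h => hcu i₁ h₁ _ ((hc i₂ h₂).res h)
      obtain ⟨v, hv, hvu⟩ := w.limit_step j hj hlim E (fun i h => (c i h).1)
        fun i₁ i₂ h₁ h₂ h => congrArg Subtype.val (hcc i₁ i₂ h₁ h₂ h)
      have hpv : p ∘ v = β ∘ w.map le_top := by
        refine (w.limit_step j hj hlim D (fun i h => β ∘ w.map le_top)
          fun i₁ i₂ h₁ h₂ h => ?_).unique (fun i h => ?_) fun i h => ?_
        · rw [Function.comp_assoc, w.map_comp]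
        · rw [Function.comp_assoc, hv i h, (c i h).2]
        · rw [Function.comp_assoc, w.map_comp]
      let l : w.Lift p β j := ⟨v, hpv⟩
      have hlc : ∀ i (h : i < j), l.res h.le = c i h := fun i h => Subtype.ext (hv i h)
      refine ⟨l, ⟨?_, fun m m' hm hm' => ?_⟩, fun l' hl' => Subtype.ext (hvu l'.1 fun i h =>
        congrArg Subtype.val (hcu i h _ (hl'.res h.le)))⟩
      · have hb : ⊥ < j := bot_lt_iff_ne_bot.mpr hj
        rw [hlc ⊥ hb, ← (hc ⊥ hb).1, Lift.res_refl]
      · have hlt : m' < j := hm'.lt_of_ne fun h => hlim m (h ▸ hm)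
        have := (hc m' hlt).2 m m' hm le_rfl
        rw [← hlc m' hlt, Lift.res_res, Lift.res_res] at this
        exact this

end

lemma liftSq (w : TransfiniteCompositionWitness P f) {E D : Type u} {p : E → D}
    (hP : ∀ {Z T : Type u} (g : Z → T), P Z T g → LiftSq g p) : LiftSq f p := by
  intro α β hαβ
  have hext : ∀ (i j : w.J) (h : i ⋖ j) (l : w.Lift p (β ∘ w.e₁) i),
      ∃ l' : w.Lift p (β ∘ w.e₁) j, l'.res h.le = l := by
    intro i j h l
    obtain ⟨l', h₁, h₂⟩ := hP _ (w.succ_step i j h) l.1 ((β ∘ w.e₁) ∘ w.map le_top) (by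
      rw [l.2, Function.comp_assoc (β ∘ w.e₁), w.map_comp])
    exact ⟨⟨l', h₂⟩, Subtype.ext h₁⟩
  choose ext hext using hext
  let l₀ : w.Lift p (β ∘ w.e₁) ⊥ := ⟨α ∘ w.e₀.symm, by
    funext x
    obtain ⟨x, rfl⟩ := w.e₀.surjective x
    have h₁ := congrFun hαβ x
    have h₂ := congrFun w.fac x
    simp only [Function.comp_apply, Equiv.symm_apply_apply] at h₁ h₂ ⊢
    rw [h₁, h₂]⟩
  obtain ⟨l, hl, -⟩ := existsUnique_isCoherent (l₀ := l₀) hext ⊤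
  refine ⟨l.1 ∘ w.e₁.symm, funext fun x => ?_, funext fun y => ?_⟩
  · have h := congrFun (congrArg Subtype.val hl.1) (w.e₀ x)
    have hf : f x = w.e₁ (w.map bot_le (w.e₀ x)) := (congrFun w.fac x).symm
    simpa [Lift.res, l₀, hf] using h
  · have h := congrFun l.2 (w.e₁.symm y)
    simpa [w.map_id] using h

end TransfiniteCompositionWitness

/-- For any set `K` of morphisms of sets, `cof(K)` is exactly the class of retracts
(in the arrow category) of transfinite compositions of pushouts of elements of `K`. -/
theorem cof_eq_retracts_of_transfinite_compositions_of_pushouts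
    {ι : Type u} {A B : ι → Type u} (k : ∀ i, A i → B i) {X Y : Type u} (f : X → Y) :
    cofF k X Y f ↔
      ∃ (Z T : Type u) (g : Z → T),
        IsTransfiniteCompositionOf (fun Z' T' (g' : Z' → T') => IsPushoutOf k g') g ∧
        IsRetract f g := by
  refine ⟨fun hf => ⟨_, _, _, isTransfiniteCompositionOf_base k _ _, hf.isRetract_base⟩, ?_⟩
  rintro ⟨Z, T, g, ⟨w⟩, hfg⟩ E D p hp
  exact (w.liftSq fun _ hg => LiftSq.of_isPushoutOf hp hg).of_isRetract_s3 hfg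
end
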